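/- Assume conditions (C), (D1), (D2), (E1) and (E2). Define R_n(λ) = n² [(1 − λ/n) − g_n(1 − λ/n)] and F_n(λ) = n [1 − h_n(1 − λ/n)] for 0 ≤ λ ≤ n (that is, the functions R_n and F_n corresponding to b_n = n). Then for every λ ≥ 0, R_n(λ) → aλ and F_n(λ) → ωλ as n → ∞, and moreover the derivatives R_n'(λ) are uniformly bounded in n on each bounded interval of [0, ∞). -/

import Mathlib

open MeasureTheory Filter Topology

/-- The probability generating function of an `ℕ`-valued distribution `p`. -/
noncomputable def pgf (p : ℕ → ℝ) (s : ℝ) : ℝ := ∑' i, p i * s ^ i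

/-- The mean `g'(1) = ∑ i * p i` of an `ℕ`-valued distribution `p`. -/
noncomputable def pgfMean (p : ℕ → ℝ) : ℝ := ∑' i : ℕ, (i : ℝ) * p i

/-- `G_n(λ) = n² [(1 − m_n λ/c_n) − g_n(1 − λ/c_n)]`. -/
noncomputable def Gseq (p : ℕ → ℕ → ℝ) (c : ℕ → ℝ) (n : ℕ) (l : ℝ) : ℝ :=
  (n : ℝ) ^ 2 * ((1 - pgfMean (p n) * l / c n) - pgf (p n) (1 - l / c n))

/-- `H_n(λ) = n [(1 − ω_n λ/c_n) − h_n(1 − λ/c_n)]`. -/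
noncomputable def Hseq (q : ℕ → ℕ → ℝ) (c : ℕ → ℝ) (n : ℕ) (l : ℝ) : ℝ :=
  (n : ℝ) * ((1 - pgfMean (q n) * l / c n) - pgf (q n) (1 - l / c n))

/-- `R_n(λ) = n² [(1 − λ/n) − g_n(1 − λ/n)]`, i.e. `R_n` for the choice `b_n = n`. -/
noncomputable def Rn (p : ℕ → ℕ → ℝ) (n : ℕ) (l : ℝ) : ℝ :=
  (n : ℝ) ^ 2 * ((1 - l / n) - pgf (p n) (1 - l / n))

/-- `F_n(λ) = n [1 − h_n(1 − λ/n)]`, i.e. `F_n` for the choice `b_n = n`. -/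
noncomputable def Fn (q : ℕ → ℕ → ℝ) (n : ℕ) (l : ℝ) : ℝ :=
  (n : ℝ) * (1 - pgf (q n) (1 - l / n))

lemma pgf_one (p : ℕ → ℝ) : pgf p 1 = ∑' i, p i := by simp [pgf]

lemma Gseq_zero (p : ℕ → ℕ → ℝ) (c : ℕ → ℝ) (hp : ∀ n, ∑' i, p n i = 1) (n : ℕ) :
    Gseq p c n 0 = 0 := by simp [Gseq, pgf_one, hp]

lemma Hseq_zero (q : ℕ → ℕ → ℝ) (c : ℕ → ℝ) (hq : ∀ n, ∑' i, q n i = 1) (n : ℕ) :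
    Hseq q c n 0 = 0 := by simp [Hseq, pgf_one, hq]

lemma Rn_eq_Gseq_add (p : ℕ → ℕ → ℝ) {c : ℕ → ℝ} (hc : ∀ n, 0 < c n) {n : ℕ} (hn : n ≠ 0)
    (l : ℝ) :
    Rn p n l = Gseq p c n (c n / n * l) + n * (pgfMean (p n) - 1) * l := by
  have hc' := (hc n).ne'
  have hn' : (n : ℝ) ≠ 0 := Nat.cast_ne_zero.2 hn
  have hl : c n / n * l / c n = l / n := by field_simp
  rw [Gseq, Rn, mul_div_assoc, hl]
  field_simp
  ring

lemma Fn_eq_Hseq_add (q : ℕ → ℕ → ℝ) {c : ℕ → ℝ} (hc : ∀ n, 0 < c n) {n : ℕ} (hn : n ≠ 0)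
    (l : ℝ) :
    Fn q n l = Hseq q c n (c n / n * l) + pgfMean (q n) * l := by
  have hc' := (hc n).ne'
  have hn' : (n : ℝ) ≠ 0 := Nat.cast_ne_zero.2 hn
  have hl : c n / n * l / c n = l / n := by field_simp
  rw [Hseq, Fn, mul_div_assoc, hl]
  field_simp
  ring

/-- A family that vanishes at `0` and is uniformly Lipschitz on bounded intervals tends to `0`
along arguments that tend to `0`. -/
lemma tendsto_comp_zero_of_uniformly_lipschitz {Φ : ℕ → ℝ → ℝ} {c r : ℕ → ℝ}
    (hc : ∀ n, 0 < c n) (hΦ : ∀ n, Φ n 0 = 0)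
    (hlip : ∀ M > (0 : ℝ), ∃ K : ℝ, ∀ (n : ℕ) (l l' : ℝ),
      l ∈ Set.Icc 0 M → l' ∈ Set.Icc 0 M → l ≤ c n → l' ≤ c n →
      |Φ n l - Φ n l'| ≤ K * |l - l'|)
    (hr0 : ∀ n, 0 ≤ r n) (hrc : ∀ᶠ n in atTop, r n ≤ c n) (hr : Tendsto r atTop (𝓝 0)) :
    Tendsto (fun n => Φ n (r n)) atTop (𝓝 0) := by
  obtain ⟨K, hK⟩ := hlip 1 one_pos
  refine squeeze_zero_norm' ?_ (by simpa using hr.const_mul K)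
  filter_upwards [hrc, hr.eventually_le_const one_pos] with n hn hn1
  simpa [hΦ, abs_of_nonneg (hr0 n)] using
    hK n (r n) 0 ⟨hr0 n, hn1⟩ ⟨le_rfl, zero_le_one⟩ hn (hc n).le

/-- At any point of a nontrivial closed interval, endpoints included, the derivative is bounded by
a Lipschitz constant on that interval. -/
lemma abs_deriv_le_of_lipschitz_Icc {f : ℝ → ℝ} {a b L x : ℝ} (hab : a < b)
    (hx : x ∈ Set.Icc a b) (hL : 0 ≤ L)
    (hf : ∀ y ∈ Set.Icc a b, |f y - f x| ≤ L * |y - x|) : |deriv f x| ≤ L := by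
  by_cases hd : DifferentiableAt ℝ f x
  · have : (𝓝[Set.Icc a b \ {x}] x).NeBot := by
      have h := ((uniqueDiffOn_Icc hab) x hx).accPt
      rwa [accPt_principal_iff_nhdsWithin] at h
    have ht := hasDerivWithinAt_iff_tendsto_slope.1
      (hd.hasDerivAt.hasDerivWithinAt (s := Set.Icc a b))
    refine le_of_tendsto ht.abs ?_
    filter_upwards [self_mem_nhdsWithin] with y hy
    rw [slope_def_field, abs_div, div_le_iff₀ (abs_pos.2 (sub_ne_zero.2 hy.2))]
    exact hf y hy.1
  · simpa [deriv_zero_of_not_differentiableAt hd] using hL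

theorem stmt6
    (p q : ℕ → ℕ → ℝ)
    (hp0 : ∀ n i, 0 ≤ p n i) (hp1 : ∀ n, ∑' i, p n i = 1)
    (hq0 : ∀ n i, 0 ≤ q n i) (hq1 : ∀ n, ∑' i, q n i = 1)
    (hpm : ∀ n, Summable fun i : ℕ => (i : ℝ) * p n i)
    (hqm : ∀ n, Summable fun i : ℕ => (i : ℝ) * q n i)
    (c : ℕ → ℝ) (hcpos : ∀ n, 0 < c n)
    (γ₀ a ω : ℝ) (hγ₀ : 0 ≤ γ₀) (hω : 0 ≤ ω)
    -- condition (C)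
    (hC1 : Tendsto (fun n : ℕ => (n : ℝ) / c n) atTop atTop)
    (hC2 : Tendsto (fun n : ℕ => (n : ℝ) / c n ^ 2) atTop (𝓝 γ₀))
    -- condition (D1)
    (hD1 : Tendsto (fun n : ℕ => (n : ℝ) * (pgfMean (p n) - 1)) atTop (𝓝 a))
    -- condition (D2)
    (G : ℝ → ℝ)
    (hGlip : ∀ M > (0 : ℝ), ∃ K : ℝ, ∀ (n : ℕ) (l l' : ℝ),
      l ∈ Set.Icc 0 M → l' ∈ Set.Icc 0 M → l ≤ c n → l' ≤ c n →
      |Gseq p c n l - Gseq p c n l'| ≤ K * |l - l'|)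
    (hGlim : ∀ l : ℝ, 0 ≤ l → Tendsto (fun n => Gseq p c n l) atTop (𝓝 (G l)))
    (hGcont : ContinuousOn G (Set.Ici 0))
    -- condition (E1)
    (hE1 : Tendsto (fun n : ℕ => pgfMean (q n)) atTop (𝓝 ω))
    -- condition (E2)
    (H : ℝ → ℝ)
    (hHlip : ∀ M > (0 : ℝ), ∃ K : ℝ, ∀ (n : ℕ) (l l' : ℝ),
      l ∈ Set.Icc 0 M → l' ∈ Set.Icc 0 M → l ≤ c n → l' ≤ c n →
      |Hseq q c n l - Hseq q c n l'| ≤ K * |l - l'|)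
    (hHlim : ∀ l : ℝ, 0 ≤ l → Tendsto (fun n => Hseq q c n l) atTop (𝓝 (H l)))
    (hHcont : ContinuousOn H (Set.Ici 0)) :
    (∀ l : ℝ, 0 ≤ l → Tendsto (fun n => Rn p n l) atTop (𝓝 (a * l))) ∧
    (∀ l : ℝ, 0 ≤ l → Tendsto (fun n => Fn q n l) atTop (𝓝 (ω * l))) ∧
    (∀ M > (0 : ℝ), ∃ K : ℝ, ∀ (n : ℕ) (l : ℝ),
      l ∈ Set.Icc 0 M → l ≤ (n : ℝ) → |deriv (Rn p n) l| ≤ K) := by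
  have hcn : Tendsto (fun n : ℕ => c n / n) atTop (𝓝 0) := by
    simpa only [Pi.inv_def, inv_div] using hC1.inv_tendsto_atTop
  have hscale0 : ∀ n : ℕ, 0 ≤ c n / n := fun n => div_nonneg (hcpos n).le n.cast_nonneg
  have hscale_le : ∀ (n : ℕ) (l : ℝ), l ≤ n → c n / n * l ≤ c n := fun n l hl => by
    rw [div_mul_eq_mul_div, mul_div_assoc]
    exact mul_le_of_le_one_right (hcpos n).le (div_le_one_of_le₀ hl n.cast_nonneg)
  have hscale_lim : ∀ l : ℝ, Tendsto (fun n : ℕ => c n / n * l) atTop (𝓝 0) := fun l => by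
    simpa using hcn.mul_const l
  have hscale_ev : ∀ l : ℝ, ∀ᶠ n : ℕ in atTop, c n / n * l ≤ c n := fun l =>
    (tendsto_natCast_atTop_atTop.eventually_ge_atTop l).mono fun n hn => hscale_le n l hn
  refine ⟨fun l hl => ?_, fun l hl => ?_, fun M hM => ?_⟩
  · have h := (tendsto_comp_zero_of_uniformly_lipschitz hcpos (Gseq_zero p c hp1) hGlip
      (fun n => mul_nonneg (hscale0 n) hl) (hscale_ev l) (hscale_lim l)).add (hD1.mul_const l)
    rw [zero_add] at h
    exact h.congr' ((eventually_ne_atTop 0).mono fun n hn => (Rn_eq_Gseq_add p hcpos hn l).symm)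
  · have h := (tendsto_comp_zero_of_uniformly_lipschitz hcpos (Hseq_zero q c hq1) hHlip
      (fun n => mul_nonneg (hscale0 n) hl) (hscale_ev l) (hscale_lim l)).add (hE1.mul_const l)
    rw [zero_add] at h
    exact h.congr' ((eventually_ne_atTop 0).mono fun n hn => (Fn_eq_Hseq_add q hcpos hn l).symm)
  · obtain ⟨B, hB⟩ := hcn.bddAbove_range
    obtain ⟨D, hD⟩ := hD1.abs.bddAbove_range
    have hB' : ∀ n : ℕ, c n / n ≤ B := fun n => hB ⟨n, rfl⟩
    have hD' : ∀ n : ℕ, |(n : ℝ) * (pgfMean (p n) - 1)| ≤ D := fun n => hD ⟨n, rfl⟩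
    have hB0 : 0 ≤ B := (hscale0 0).trans (hB' 0)
    have hD0 : 0 ≤ D := (abs_nonneg _).trans (hD' 0)
    obtain ⟨K, hK⟩ := hGlip (B * M + 1) (by positivity)
    refine ⟨|K| * B + D, fun n l hl hln => ?_⟩
    rcases eq_or_ne n 0 with rfl | hn
    · have : Rn p 0 = fun _ => 0 := by ext; simp [Rn]
      rw [this, deriv_const, abs_zero]
      positivity
    have hmem : ∀ x ∈ Set.Icc 0 (min M n), c n / n * x ∈ Set.Icc 0 (B * M + 1) := fun x hx =>
      ⟨mul_nonneg (hscale0 n) hx.1,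
        (mul_le_mul (hB' n) (hx.2.trans (min_le_left _ _)) hx.1 hB0).trans (by linarith)⟩
    have hl' : l ∈ Set.Icc 0 (min M (n : ℝ)) := ⟨hl.1, le_min hl.2 hln⟩
    refine abs_deriv_le_of_lipschitz_Icc (lt_min hM (by positivity)) hl' (by positivity)
      fun y hy => ?_
    rw [Rn_eq_Gseq_add p hcpos hn, Rn_eq_Gseq_add p hcpos hn, add_sub_add_comm, ← mul_sub, add_mul]
    refine (abs_add_le _ _).trans (add_le_add ?_ ?_)
    · refine (hK n _ _ (hmem y hy) (hmem l hl')
        (hscale_le n y (hy.2.trans (min_le_right _ _))) (hscale_le n l hln)).trans ?_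
      rw [← mul_sub, abs_mul, abs_of_nonneg (hscale0 n), mul_assoc]
      exact mul_le_mul (le_abs_self K) (mul_le_mul_of_nonneg_right (hB' n) (abs_nonneg _))
        (mul_nonneg (hscale0 n) (abs_nonneg _)) (abs_nonneg K)
    · rw [abs_mul]
      exact mul_le_mul_of_nonneg_right (hD' n) (abs_nonneg _)
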